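/- For every rate parameter λ > 0, the expected value of the natural logarithm of an exponentially distributed random variable with rate λ equals -(ln λ + γ), where γ is the Euler–Mascheroni constant; that is, ∫_{0}^{∞} λ e^{-λ z} ln z dz = -(ln λ + γ). -/

import Mathlib

open MeasureTheory Real

/-- The integral of the logarithm against the standard exponential density is `-γ`. -/
theorem integral_exp_neg_mul_log_Ioi :
    ∫ t in Set.Ioi (0 : ℝ), Real.exp (-t) * Real.log t = -Real.eulerMascheroniConstant := by
  have hderiv : HasDerivAt Complex.Gamma
      (∫ t : ℝ in Set.Ioi 0, (t : ℂ) ^ ((1 : ℂ) - 1) * (Real.log t * Real.exp (-t))) 1 := by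
    refine (Complex.hasDerivAt_GammaIntegral (s := 1) (by simp)).congr_of_eventuallyEq ?_
    filter_upwards [(isOpen_lt continuous_const Complex.continuous_re).mem_nhds
      (show (0 : ℝ) < (1 : ℂ).re by simp)] with s hs
    exact Complex.Gamma_eq_integral hs
  have heq := hderiv.unique Complex.hasDerivAt_Gamma_one
  apply Complex.ofReal_injective
  rw [← integral_complex_ofReal, Complex.ofReal_neg, ← heq]
  refine integral_congr_ae (Filter.Eventually.of_forall fun t ↦ ?_)
  simp [mul_comm]

theorem integrableOn_exp_neg_mul_log_Ioi :
    IntegrableOn (fun t ↦ Real.exp (-t) * Real.log t) (Set.Ioi (0 : ℝ)) := by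
  refine Integrable.of_integral_ne_zero ?_
  rw [integral_exp_neg_mul_log_Ioi]
  linarith [Real.one_half_lt_eulerMascheroniConstant]

/-- For every rate parameter `l > 0`, the expected value of the natural logarithm of an
exponentially distributed random variable with rate `l` equals `-(ln l + γ)`, where `γ` is
the Euler–Mascheroni constant. -/
theorem exp_dist_expected_log (l : ℝ) (hl : 0 < l) :
    ∫ z in Set.Ioi (0 : ℝ), l * Real.exp (-l * z) * Real.log z
      = -(Real.log l + Real.eulerMascheroniConstant) := by
  calc ∫ z in Set.Ioi (0 : ℝ), l * Real.exp (-l * z) * Real.log z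
      = ∫ z in Set.Ioi (0 : ℝ),
          l * (Real.exp (-(l * z)) * Real.log (l * z) - Real.exp (-(l * z)) * Real.log l) := by
        refine setIntegral_congr_fun measurableSet_Ioi fun z hz ↦ ?_
        simp only [Real.log_mul hl.ne' (ne_of_gt hz), neg_mul]
        ring
    _ = ∫ t in Set.Ioi (0 : ℝ), (Real.exp (-t) * Real.log t - Real.exp (-t) * Real.log l) := by
        rw [integral_const_mul]
        simpa using integral_comp_mul_left_Ioi'
          (fun t ↦ Real.exp (-t) * Real.log t - Real.exp (-t) * Real.log l) 0 hl
    _ = -(Real.log l + Real.eulerMascheroniConstant) := by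
        rw [integral_sub integrableOn_exp_neg_mul_log_Ioi
          ((integrableOn_exp_neg_Ioi 0).mul_const _), integral_exp_neg_mul_log_Ioi,
          integral_mul_const, integral_exp_neg_Ioi_zero]
        ring
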